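/- Let C be a C*-algebra, J a closed two-sided ideal of C, and (b_k)_{k∈ℕ} a sequence of positive elements of C such that for every k ∈ ℕ, every positive element a ∈ J, and every ε > 0, there exist a positive element d ∈ closure{ b_k·y·b_k : y ∈ J } and an element r ∈ J with ‖r*·d·r − a‖ < ε. Then for every separable subset S of C there exists a closed *-subalgebra A of C such that A is separable (as a topological space), { b_k : k ∈ ℕ } ∪ S ⊆ A, and for every k ∈ ℕ the hereditary subalgebra closure{ b_k·y·b_k : y ∈ A ∩ J } is full in the C*-algebra A ∩ J, i.e. the smallest closed two-sided ideal of A ∩ J containing it is A ∩ J itself. -/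

import Mathlib

open Set

/-- A countable set is contained in a countable set closed under a countable family of
binary operations. -/
theorem Set.Countable.exists_superset_closed_binary {α : Type*} {T : Set α} (hT : T.Countable)
    {G : Set (α → α → α)} (hG : G.Countable) :
    ∃ D : Set α, D.Countable ∧ T ⊆ D ∧ ∀ g ∈ G, ∀ x ∈ D, ∀ y ∈ D, g x y ∈ D := by
  let step : Set α → Set α := fun X => X ∪ ⋃ g ∈ G, Set.image2 g X X
  let E : ℕ → Set α := fun n => step^[n] T
  have hsucc (n : ℕ) : E (n + 1) = step (E n) := Function.iterate_succ_apply' step n T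
  have hmono : Monotone E := monotone_nat_of_le_succ fun n => by
    rw [hsucc]
    exact subset_union_left
  have hcount (n : ℕ) : (E n).Countable := by
    induction n with
    | zero => exact hT
    | succ n ih =>
      rw [hsucc]
      exact ih.union (hG.biUnion fun g _ => ih.image2 ih g)
  refine ⟨⋃ n, E n, countable_iUnion hcount, subset_iUnion E 0, fun g hg x hx y hy => ?_⟩
  obtain ⟨m, hm⟩ := mem_iUnion.1 hx
  obtain ⟨n, hn⟩ := mem_iUnion.1 hy
  refine mem_iUnion.2 ⟨max m n + 1, ?_⟩
  rw [hsucc]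
  exact Or.inr (mem_biUnion hg (mem_image2_of_mem (hmono (le_max_left m n) hm)
    (hmono (le_max_right m n) hn)))

section CStarAlgebra

variable {C : Type*} [NonUnitalCStarAlgebra C]

theorem star_mul_self_sub_mul_cfcₙ (x : C) {g : ℝ → ℝ}
    (hg : ContinuousOn g (quasispectrum ℝ (star x * x))) (hg0 : g 0 = 0) :
    star (x - x * cfcₙ g (star x * x)) * (x - x * cfcₙ g (star x * x)) =
      cfcₙ (fun t => t - t * g t - g t * (t - t * g t)) (star x * x) := by
  set a := star x * x with ha
  have hsa : IsSelfAdjoint a := .star_mul_self x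
  have hqsa : star (cfcₙ g a) = cfcₙ g a := (cfcₙ_predicate g a : IsSelfAdjoint _)
  have hh : ContinuousOn (fun t => t - t * g t) (quasispectrum ℝ a) := by fun_prop
  have hr : cfcₙ (fun t => t - t * g t) a = a - a * cfcₙ g a := by
    rw [cfcₙ_sub (fun t => t) (fun t => t * g t) a, cfcₙ_mul (fun t => t) g a, cfcₙ_id' ℝ a]
  rw [cfcₙ_sub (fun t => t - t * g t) (fun t => g t * (t - t * g t)) a,
    cfcₙ_mul g (fun t => t - t * g t) a, hr, star_sub, star_mul, hqsa, ha]
  noncomm_ring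

/-- Every element `x` is approximated by `x * (star p * p)` with `p` in the closed real algebra
generated by `star x * x`; moreover `p` can be taken in the ideal generated by `x`. -/
theorem exists_mem_elemental_norm_sub_mul_star_mul_self_lt (x : C) {ε : ℝ} (hε : 0 < ε) :
    ∃ p ∈ NonUnitalStarAlgebra.elemental ℝ (star x * x),
      (∃ w, p = w * (x - x * p)) ∧ ‖x - x * (star p * p)‖ < ε := by
  let : PartialOrder C := CStarAlgebra.spectralOrder C
  have : StarOrderedRing C := CStarAlgebra.spectralOrderedRing C
  set a := star x * x with ha_def
  have ha : 0 ≤ a := star_mul_self_nonneg x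
  have hsa : IsSelfAdjoint a := ha.isSelfAdjoint
  obtain ⟨δ, hδ, hδε⟩ : ∃ δ : ℝ, 0 < δ ∧ δ < ε ^ 2 := exists_between (by positivity)
  let f : ℝ → ℝ := fun t => t / (t + δ)
  have hspec : ∀ t ∈ quasispectrum ℝ a, 0 ≤ t := quasispectrum_nonneg_of_nonneg a ha
  have hf : ContinuousOn f (quasispectrum ℝ a) :=
    continuousOn_id.div (by fun_prop) fun t ht => by
      have := hspec t ht
      positivity
  have hf0 : f 0 = 0 := by simp [f]
  set p := cfcₙ f a
  have hpsa : star p = p := (cfcₙ_predicate f a : IsSelfAdjoint _)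
  have hid : cfcₙ (fun t : ℝ => t) a = a := cfcₙ_id' ℝ a
  have hap : a * p = cfcₙ (fun t => t * f t) a := by
    rw [cfcₙ_mul (fun t => t) f a, hid]
  refine ⟨p, cfcₙ_mem_elemental f a, ⟨δ⁻¹ • star x, ?_⟩, ?_⟩
  · have : a - a * p = cfcₙ (fun t => t - t * f t) a := by
      rw [cfcₙ_sub (fun t => t) (fun t => t * f t) a, hid, hap]
    rw [smul_mul_assoc, mul_sub, ← mul_assoc, ← ha_def, this, ← cfcₙ_smul δ⁻¹ _ a]
    refine cfcₙ_congr fun t ht => ?_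
    have := hspec t ht
    simp only [f, smul_eq_mul]
    field_simp
    ring
  · have hq : star p * p = cfcₙ (fun t => f t * f t) a := by
      rw [hpsa, cfcₙ_mul f f a]
    set q := star p * p
    have hcalc := star_mul_self_sub_mul_cfcₙ x (g := fun t => f t * f t) (hf.mul hf)
      (by simp [hf0])
    rw [← ha_def, ← hq] at hcalc
    have hle : ‖star (x - x * q) * (x - x * q)‖ ≤ δ := by
      rw [hcalc]
      refine norm_cfcₙ_le fun t ht => ?_
      have ht0 := hspec t ht
      have hkey : t - t * (f t * f t) - f t * f t * (t - t * (f t * f t)) =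
          t * (2 * t * δ + δ ^ 2) ^ 2 / (t + δ) ^ 4 := by
        simp only [f]
        field_simp
        ring
      rw [hkey, Real.norm_of_nonneg (by positivity), div_le_iff₀ (by positivity)]
      have h₁ : (2 * t * δ + δ ^ 2) ^ 2 ≤ (2 * δ * (t + δ)) ^ 2 := by
        gcongr
        nlinarith
      have h₂ : 4 * t * δ ≤ (t + δ) ^ 2 := by nlinarith [sq_nonneg (t - δ)]
      calc t * (2 * t * δ + δ ^ 2) ^ 2 ≤ t * (2 * δ * (t + δ)) ^ 2 := by gcongr
        _ = δ * ((4 * t * δ) * (t + δ) ^ 2) := by ring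
        _ ≤ δ * ((t + δ) ^ 2 * (t + δ) ^ 2) := by gcongr
        _ = δ * (t + δ) ^ 4 := by ring
    rw [CStarRing.norm_star_mul_self] at hle
    nlinarith [norm_nonneg (x - x * q)]

/-- A closed two-sided ideal of a C*-algebra is self-adjoint. -/
theorem TwoSidedIdeal.star_mem_of_isClosed {J : TwoSidedIdeal C} (hJ : IsClosed (J : Set C))
    {x : C} (hx : x ∈ J) : star x ∈ J := by
  refine hJ.closure_subset (Metric.mem_closure_iff.2 fun ε hε => ?_)
  obtain ⟨p, -, ⟨w, hw⟩, hlt⟩ := exists_mem_elemental_norm_sub_mul_star_mul_self_lt x hε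
  have hp : p ∈ J := by
    rw [hw]
    exact J.mul_mem_left _ _ (J.sub_mem hx (J.mul_mem_right _ _ hx))
  refine ⟨star (x * (star p * p)), ?_, ?_⟩
  · rw [star_mul, star_mul, star_star]
    exact J.mul_mem_right _ _ (J.mul_mem_left _ _ hp)
  · rwa [dist_eq_norm, ← star_sub, norm_star]

/-- The closure of a nonempty set closed under addition, multiplication, star and a dense set of
scalars, as a star subalgebra. -/
def NonUnitalStarSubalgebra.ofClosure (D : Set C) (zero_mem : 0 ∈ D)
    (add_mem : ∀ x ∈ D, ∀ y ∈ D, x + y ∈ D) (mul_mem : ∀ x ∈ D, ∀ y ∈ D, x * y ∈ D)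
    (star_mem : ∀ x ∈ D, star x ∈ D) (Z : Set ℂ) (hZ : Dense Z)
    (smul_mem : ∀ c ∈ Z, ∀ x ∈ D, c • x ∈ D) : NonUnitalStarSubalgebra ℂ C where
  carrier := closure D
  zero_mem' := subset_closure zero_mem
  add_mem' hx hy := map_mem_closure₂ continuous_add hx hy add_mem
  mul_mem' hx hy := map_mem_closure₂ continuous_mul hx hy mul_mem
  star_mem' hx := map_mem_closure continuous_star hx star_mem
  smul_mem' c _ hx := map_mem_closure₂ continuous_smul (hZ c) hx smul_mem

/-- A closed complex star subalgebra contains the closed real star subalgebras generated by its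
elements. -/
theorem NonUnitalStarSubalgebra.mem_of_mem_elemental_real {A : NonUnitalStarSubalgebra ℂ C}
    (hA : IsClosed (A : Set C)) {a p : C} (ha : a ∈ A)
    (hp : p ∈ NonUnitalStarAlgebra.elemental ℝ a) : p ∈ A :=
  have := SMulMemClass.ofIsScalarTower (NonUnitalStarSubalgebra ℂ C) ℝ ℂ C
  NonUnitalStarAlgebra.elemental.le_of_mem (s := .ofClass A) hA ha hp

/-- If a closed set contains every `star p * p` for `p ∈ A ∩ J` and absorbs left
multiplication by `A ∩ J`, then it contains `A ∩ J`. -/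
theorem inter_subset_of_star_mul_self_mem {A : NonUnitalStarSubalgebra ℂ C}
    (hA : IsClosed (A : Set C)) {J : TwoSidedIdeal C} {I : Set C} (hI : IsClosed I)
    (hmul : ∀ x ∈ (A : Set C) ∩ (J : Set C), ∀ a ∈ I, x * a ∈ I)
    (hstar : ∀ p ∈ (A : Set C) ∩ (J : Set C), star p * p ∈ I) :
    (A : Set C) ∩ (J : Set C) ⊆ I := by
  rintro x ⟨hxA, hxJ⟩
  refine hI.closure_subset (Metric.mem_closure_iff.2 fun ε hε => ?_)
  obtain ⟨p, hp, ⟨w, hw⟩, hlt⟩ := exists_mem_elemental_norm_sub_mul_star_mul_self_lt x hε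
  have hpJ : p ∈ J := by
    rw [hw]
    exact J.mul_mem_left _ _ (J.sub_mem hxJ (J.mul_mem_right _ _ hxJ))
  have hpA : p ∈ A :=
    NonUnitalStarSubalgebra.mem_of_mem_elemental_real hA (mul_mem (star_mem hxA) hxA) hp
  refine ⟨x * (star p * p), hmul x ⟨hxA, hxJ⟩ _ (hstar p ⟨hpA, hpJ⟩), ?_⟩
  rwa [dist_eq_norm]

/-- A point of `K` which is a limit of points of `D` is a limit of points of
`D ∩ K`, provided `D` contains almost best approximations in `K` of its points. -/
theorem closure_inter_subset_closure_inter {X : Type*} [PseudoMetricSpace X] {D K : Set X}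
    (hD : ∀ x ∈ D, ∀ n : ℕ, ∃ z ∈ D ∩ K, dist x z < Metric.infDist x K + 1 / (n + 1)) :
    closure D ∩ K ⊆ closure (D ∩ K) := by
  rintro x ⟨hxD, hxK⟩
  refine Metric.mem_closure_iff.2 fun ε hε => ?_
  obtain ⟨y, hy, hxy⟩ := Metric.mem_closure_iff.1 hxD (ε / 3) (by positivity)
  obtain ⟨n, hn⟩ := exists_nat_one_div_lt (show 0 < ε / 3 by positivity)
  obtain ⟨z, hz, hyz⟩ := hD y hy n
  refine ⟨z, hz, ?_⟩
  have h₁ : Metric.infDist y K ≤ dist y x := Metric.infDist_le_dist_of_mem hxK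
  have h₂ := dist_triangle x y z
  rw [dist_comm y x] at h₁
  linarith

end CStarAlgebra

/-- Let `C` be a C*-algebra, `J` a closed two-sided ideal of `C`, and `(b_k)` a
sequence of positive elements of `C` such that every positive `a ∈ J` can be approximated, to
within any `ε > 0`, by `r* d r` with `d` a positive element of the hereditary subalgebra
`closure (b_k J b_k)` and `r ∈ J`.  Then every separable subset `S` of `C` is contained in a
closed separable *-subalgebra `A` of `C` containing all the `b_k`, such that for every `k` the
hereditary subalgebra `closure {b_k y b_k : y ∈ A ∩ J}` is full in `A ∩ J`: every closed
two-sided ideal of `A ∩ J` containing `{b_k y b_k : y ∈ A ∩ J}` equals `A ∩ J`. -/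
theorem stmt8 {C : Type*} [NonUnitalCStarAlgebra C] [PartialOrder C] [StarOrderedRing C]
    (J : TwoSidedIdeal C) (hJ : IsClosed (J : Set C))
    (b : ℕ → C) (hbpos : ∀ k, 0 ≤ b k)
    (happrox : ∀ k, ∀ a : C, a ∈ J → 0 ≤ a → ∀ ε : ℝ, 0 < ε →
      ∃ d ∈ closure {z : C | ∃ y ∈ J, z = b k * y * b k}, 0 ≤ d ∧
        ∃ r ∈ J, ‖star r * d * r - a‖ < ε)
    (S : Set C) (hS : TopologicalSpace.IsSeparable S) :
    ∃ A : NonUnitalStarSubalgebra ℂ C, IsClosed (A : Set C) ∧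
      TopologicalSpace.SeparableSpace A ∧ (∀ k, b k ∈ A) ∧ S ⊆ (A : Set C) ∧
      ∀ k, ∀ I : Set C, I ⊆ (A : Set C) ∩ (J : Set C) → IsClosed I →
        (0 : C) ∈ I → (∀ x ∈ I, ∀ y ∈ I, x + y ∈ I) → (∀ x ∈ I, -x ∈ I) →
        (∀ x ∈ (A : Set C) ∩ (J : Set C), ∀ a ∈ I, x * a ∈ I ∧ a * x ∈ I) →
        {z : C | ∃ y ∈ (A : Set C) ∩ (J : Set C), z = b k * y * b k} ⊆ I →
        I = (A : Set C) ∩ (J : Set C) := by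
  have happrox' : ∀ (k n : ℕ) (c : C), ∃ y r : C, c ∈ J → y ∈ J ∧ r ∈ J ∧
      ‖star r * (b k * y * b k) * r - star c * c‖ < 1 / ((n : ℝ) + 1) := by
    intro k n c
    by_cases hc : c ∈ J
    · obtain ⟨d, hd, -, r, hr, hlt⟩ := happrox k (star c * c) (J.mul_mem_left _ _ hc)
        (star_mul_self_nonneg c) (1 / ((n : ℝ) + 1)) (by positivity)
      have hopen : IsOpen {z : C | ‖star r * z * r - star c * c‖ < 1 / ((n : ℝ) + 1)} :=
        isOpen_lt (by fun_prop) continuous_const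
      obtain ⟨_, hz, y, hy, rfl⟩ := mem_closure_iff.1 hd _ hopen hlt
      exact ⟨y, r, fun _ => ⟨hy, hr, hz⟩⟩
    · exact ⟨0, 0, fun h => absurd h hc⟩
  choose Y R hYR using happrox'
  have hnear : ∀ (n : ℕ) (c : C), ∃ z ∈ (J : Set C),
      dist c z < Metric.infDist c (J : Set C) + 1 / ((n : ℝ) + 1) := fun n c =>
    (Metric.infDist_lt_iff ⟨0, J.zero_mem⟩).1 (lt_add_of_pos_right _ (by positivity))
  choose F hFJ hF using hnear
  obtain ⟨T, hT, hST⟩ := hS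
  obtain ⟨Z, hZc, hZ⟩ := TopologicalSpace.exists_countable_dense ℂ
  let G : Set (C → C → C) :=
    {(· + ·), (· * ·), fun x _ => star x} ∪ (fun (c : ℂ) (x _ : C) => c • x) '' Z ∪
      (range (fun (n : ℕ) (x _ : C) => F n x)) ∪
      (range (fun (i : ℕ × ℕ) (x _ : C) => Y i.1 i.2 x)) ∪
      (range (fun (i : ℕ × ℕ) (x _ : C) => R i.1 i.2 x))
  have hG : G.Countable :=
    (((((toFinite _).countable).union (hZc.image _)).union (countable_range _)).union
      (countable_range _)).union (countable_range _)
  obtain ⟨D, hDc, hTD, hD⟩ := ((hT.union (countable_range b)).insert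
    (0 : C)).exists_superset_closed_binary hG
  have h0D : (0 : C) ∈ D := hTD (mem_insert _ _)
  have hFD (n : ℕ) (x : C) (hx : x ∈ D) : F n x ∈ D :=
    hD _ (Or.inl (Or.inl (Or.inr ⟨n, rfl⟩))) x hx x hx
  have hYD (k n : ℕ) (x : C) (hx : x ∈ D) : Y k n x ∈ D :=
    hD _ (Or.inl (Or.inr ⟨(k, n), rfl⟩)) x hx x hx
  have hRD (k n : ℕ) (x : C) (hx : x ∈ D) : R k n x ∈ D :=
    hD _ (Or.inr ⟨(k, n), rfl⟩) x hx x hx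
  let A : NonUnitalStarSubalgebra ℂ C := .ofClosure D h0D
    (hD (· + ·) (by simp [G])) (hD (· * ·) (by simp [G]))
    (fun x hx => hD (fun x _ => star x) (by simp [G]) x hx x hx) Z hZ
    (fun c hc x hx => hD _ (Or.inl (Or.inl (Or.inl (Or.inr ⟨c, hc, rfl⟩)))) x hx x hx)
  have hDA : D ⊆ (A : Set C) := subset_closure
  have hAJ : (A : Set C) ∩ (J : Set C) ⊆ closure (D ∩ (J : Set C)) :=
    closure_inter_subset_closure_inter fun x hx n => ⟨F n x, ⟨hFD n x hx, hFJ n x⟩, hF n x⟩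
  have hA : IsClosed (A : Set C) := isClosed_closure
  refine ⟨A, hA, hDc.isSeparable.closure.separableSpace,
    fun k => hDA (hTD (Or.inr (Or.inr ⟨k, rfl⟩))),
    hST.trans (closure_mono fun x hx => hTD (Or.inr (Or.inl hx))), ?_⟩
  intro k I hIsub hI _ _ _ hmul hbI
  refine hIsub.antisymm (inter_subset_of_star_mul_self_mem hA hI
    (fun x hx a ha => (hmul x hx a ha).1) fun p hp => ?_)
  refine hI.closure_subset (map_mem_closure (f := fun c : C => star c * c) (by fun_prop)
    (hAJ hp) ?_)
  rintro c ⟨hcD, hcJ⟩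
  refine hI.closure_subset (Metric.mem_closure_iff.2 fun ε hε => ?_)
  obtain ⟨n, hn⟩ := exists_nat_one_div_lt hε
  obtain ⟨hy, hr, hlt⟩ := hYR k n c hcJ
  have hrA : R k n c ∈ A := hDA (hRD k n c hcD)
  refine ⟨_, (hmul _ ⟨hrA, hr⟩ _ (hmul (star (R k n c))
    ⟨star_mem hrA, TwoSidedIdeal.star_mem_of_isClosed hJ hr⟩ _
      (hbI ⟨Y k n c, ⟨hDA (hYD k n c hcD), hy⟩, rfl⟩)).1).2, ?_⟩
  rw [dist_comm, dist_eq_norm]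
  exact hlt.trans hn
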